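/- Let r be a natural number, and let N be a family of nonnegative real numbers N_{d,α}, indexed by pairs (d, α) with d ≥ 1 a natural number and α = (a₁,…,a_r) an r-tuple of natural numbers satisfying a₁ + ⋯ + a_r ≤ 3d − 1. Suppose that: (i) for every such pair, N_{d,α} ≤ N_{d,0} / (a₁!·⋯·a_r!), where N_{d,0} is the value at α = (0,…,0); and (ii) for every d ≥ 1, N_{d,0} / (3d−1)! ≤ (45/16)·(4/5)^d·d^{−7/2}. Then for all complex numbers q₁, q₂, …, q_{r+1}, t_p satisfying (4/5)·|q₁|·(|t_p| + |q₂| + ⋯ + |q_{r+1}|)³ < 1, the family of complex numbers N_{d,α} · q₁^d · q₂^{a₁}·⋯·q_{r+1}^{a_r} · t_p^{3d−1−|α|} / (3d−1−|α|)!, indexed by all pairs (d, α) as above (where |α| = a₁ + ⋯ + a_r), is absolutely summable. -/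

import Mathlib

open Finset in
/-- The multinomial theorem in exponential form. -/
theorem sum_piAntidiag_prod_pow_div_factorial {ι : Type*} [Fintype ι] [DecidableEq ι]
    (x : ι → ℝ) (n : ℕ) :
    ∑ k ∈ piAntidiag univ n, ∏ i, x i ^ k i / (Nat.factorial (k i) : ℝ) =
      (∑ i, x i) ^ n / (Nat.factorial n : ℝ) := by
  rw [sum_pow_eq_sum_piAntidiag, sum_div]
  refine sum_congr rfl fun k hk => ?_
  have hsum : ∑ i, k i = n := (mem_piAntidiag.mp hk).1
  have hspec : (∏ i, (Nat.factorial (k i) : ℝ)) * (Nat.multinomial univ k : ℝ) =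
      (Nat.factorial n : ℝ) := by
    rw [← hsum]
    exact_mod_cast Nat.multinomial_spec univ k
  have hne : ∏ i, (Nat.factorial (k i) : ℝ) ≠ 0 :=
    prod_ne_zero_iff.mpr fun i _ => by positivity
  have hn : (Nat.factorial n : ℝ) ≠ 0 := by positivity
  rw [prod_div_distrib, div_eq_div_iff hne hn, ← hspec]
  ring

open Finset in
/-- Weighted exponential monomials, graded by total degree, form a summable family as soon as
the weighted sums of their homogeneous parts do. -/
theorem summable_sigma_piAntidiag_prod_pow_div_factorial {ι : Type*} [Fintype ι] [DecidableEq ι]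
    {x : ι → ℝ} (hx : ∀ i, 0 ≤ x i) {c : ℕ → ℝ} (hc : ∀ d, 0 ≤ c d) (n : ℕ → ℕ)
    (h : Summable fun d => c d * ((∑ i, x i) ^ n d / (Nat.factorial (n d) : ℝ))) :
    Summable fun p : Σ d : ℕ, piAntidiag (univ : Finset ι) (n d) =>
      c p.1 * ∏ i, x i ^ p.2.1 i / (Nat.factorial (p.2.1 i) : ℝ) := by
  refine (summable_sigma_of_nonneg fun p => mul_nonneg (hc _) <| prod_nonneg fun i _ =>
    div_nonneg (pow_nonneg (hx i) _) (Nat.cast_nonneg _)).mpr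
      ⟨fun d => Summable.of_finite, h.congr fun d => ?_⟩
  rw [← sum_piAntidiag_prod_pow_div_factorial, mul_sum]
  exact (Finset.tsum_subtype (piAntidiag univ (n d))
    fun k => c d * ∏ i, x i ^ k i / (Nat.factorial (k i) : ℝ)).symm


/-- Absolute summability of the genus-zero Gromov–Witten potential of the plane
blown up at `r` points, given the factorial bound and the asymptotic growth bound. -/
theorem gw_potential_summable (r : ℕ) (N : ℕ → (Fin r → ℕ) → ℝ)
    (hnn : ∀ (d : ℕ) (α : Fin r → ℕ), 1 ≤ d → ∑ i, α i ≤ 3 * d - 1 → 0 ≤ N d α)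
    (hfact : ∀ (d : ℕ) (α : Fin r → ℕ), 1 ≤ d → ∑ i, α i ≤ 3 * d - 1 →
      N d α ≤ N d 0 / ∏ i, (Nat.factorial (α i) : ℝ))
    (hgrowth : ∀ d : ℕ, 1 ≤ d →
      N d 0 / (Nat.factorial (3 * d - 1) : ℝ) ≤
        (45 / 16) * (4 / 5) ^ d * (d : ℝ) ^ (-(7 : ℝ) / 2))
    (q₁ : ℂ) (qe : Fin r → ℂ) (tp : ℂ)
    (hq : (4 / 5) * ‖q₁‖ * (‖tp‖ + ∑ i, ‖qe i‖) ^ 3 < 1) :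
    Summable (fun p : {p : ℕ × (Fin r → ℕ) // 1 ≤ p.1 ∧ ∑ i, p.2 i ≤ 3 * p.1 - 1} =>
      ‖(N p.1.1 p.1.2 : ℂ) * q₁ ^ p.1.1 * (∏ i, qe i ^ p.1.2 i) *
        tp ^ (3 * p.1.1 - 1 - ∑ i, p.1.2 i) /
        ((Nat.factorial (3 * p.1.1 - 1 - ∑ i, p.1.2 i) : ℂ))‖) := by
  classical
  let x : Fin (r + 1) → ℝ := Fin.cons ‖tp‖ fun i => ‖qe i‖
  let c : ℕ → ℝ := fun d => (45 / 16) * (4 / 5) ^ d * (Nat.factorial (3 * d - 1) : ℝ) * ‖q₁‖ ^ d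
  have hx : ∀ i, 0 ≤ x i := Fin.cases (norm_nonneg _) fun i => norm_nonneg _
  have hxsum : ∑ i, x i = ‖tp‖ + ∑ i, ‖qe i‖ := by simp [x, Fin.sum_univ_succ]
  have hc : ∀ d, 0 ≤ c d := fun d => by positivity
  set S : ℝ := ‖tp‖ + ∑ i, ‖qe i‖
  have hS0 : 0 ≤ S := by positivity
  have hgeom : Summable fun d =>
      c d * ((∑ i, x i) ^ (3 * d - 1) / (Nat.factorial (3 * d - 1) : ℝ)) := by
    rw [← summable_nat_add_iff 1]
    refine ((summable_geometric_of_lt_one (by positivity) hq).mul_left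
      ((45 / 16) * (4 / 5) * ‖q₁‖ * S ^ 2)).congr fun d => ?_
    have hd : 3 * (d + 1) - 1 = 3 * d + 2 := by omega
    have hf : (Nat.factorial (3 * d + 2) : ℝ) ≠ 0 := by positivity
    simp only [c, hd, hxsum]
    field_simp
    ring_nf
  have hsum := summable_sigma_piAntidiag_prod_pow_div_factorial hx hc (fun d => 3 * d - 1) hgeom
  let e : {p : ℕ × (Fin r → ℕ) // 1 ≤ p.1 ∧ ∑ i, p.2 i ≤ 3 * p.1 - 1} →
      Σ d : ℕ, Finset.piAntidiag (Finset.univ : Finset (Fin (r + 1))) (3 * d - 1) :=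
    fun p => ⟨p.1.1, Fin.cons (3 * p.1.1 - 1 - ∑ i, p.1.2 i) p.1.2, by
      have := p.2.2
      simp only [Finset.mem_piAntidiag, Fin.sum_univ_succ, Fin.cons_zero, Fin.cons_succ,
        Finset.mem_univ, implies_true, and_true]
      omega⟩
  have he : Function.Injective e := by
    intro p p' h
    have := congrArg (fun s : Σ d : ℕ,
      Finset.piAntidiag (Finset.univ : Finset (Fin (r + 1))) (3 * d - 1) =>
        (s.1, Fin.tail s.2.1)) h
    exact Subtype.ext (by simpa [e] using this)
  refine (hsum.comp_injective he).of_nonneg_of_le (fun p => norm_nonneg _) ?_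
  rintro ⟨⟨d, α⟩, hd, hα⟩
  dsimp only at hd hα
  have hN0 : N d 0 ≤ (45 / 16) * (4 / 5) ^ d * (Nat.factorial (3 * d - 1) : ℝ) := by
    have hpow : (d : ℝ) ^ (-(7 : ℝ) / 2) ≤ 1 :=
      Real.rpow_le_one_of_one_le_of_nonpos (by exact_mod_cast hd) (by norm_num)
    rw [← div_le_iff₀ (by positivity)]
    exact (hgrowth d hd).trans (mul_le_of_le_one_right (by positivity) hpow)
  have hN : N d α ≤ (45 / 16) * (4 / 5) ^ d * (Nat.factorial (3 * d - 1) : ℝ) /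
      ∏ i, (Nat.factorial (α i) : ℝ) :=
    (hfact d α hd hα).trans (by gcongr)
  simp only [Function.comp_apply, e, c, x, Fin.prod_univ_succ, Fin.cons_zero, Fin.cons_succ,
    norm_mul, norm_div, norm_pow, norm_prod, Complex.norm_real, Complex.norm_natCast,
    Real.norm_of_nonneg (hnn d α hd hα), Finset.prod_div_distrib]
  set m := 3 * d - 1 - ∑ i, α i
  calc
    _ ≤ (45 / 16) * (4 / 5) ^ d * (Nat.factorial (3 * d - 1) : ℝ) /
          (∏ i, (Nat.factorial (α i) : ℝ)) * ‖q₁‖ ^ d * (∏ i, ‖qe i‖ ^ α i) * ‖tp‖ ^ m /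
          (Nat.factorial m : ℝ) := by gcongr
    _ = _ := by ring
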